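/- Exact flat-to-flat interconversion rate: let p and q be flat probability vectors of dimension d with D(q) > 0, and let ε ∈ [0,1). Then for every n ∈ ℕ, R*_0(n,ε) = (1/n)·⌊(n·D(p) − log(1−ε))/D(q)⌋. -/

import Mathlib

open Finset Filter

noncomputable section

/-- A probability vector: nonnegative entries summing to 1. -/
def IsProbVec {ι : Type*} [Fintype ι] (p : ι → ℝ) : Prop :=
  (∀ i, 0 ≤ p i) ∧ ∑ i, p i = 1

/-- The sum of the `k` largest entries of `p`: the largest sum over subsets of at
most `k` indices (for nonnegative vectors this equals the sorted partial sum,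
with zero padding beyond the dimension). -/
def kMaxSum {ι : Type*} [Fintype ι] (p : ι → ℝ) (k : ℕ) : ℝ :=
  (Finset.univ.powerset.filter (fun s : Finset ι => s.card ≤ k)).sup'
    ⟨∅, by simp⟩ (fun s => ∑ i ∈ s, p i)

/-- `p ≻ q`: for every `k`, the sum of the `k` largest entries of `p` is at least
that of `q` (dimensions may differ, the shorter padded with zeros). -/
def Majorises {ι κ : Type*} [Fintype ι] [Fintype κ] (p : ι → ℝ) (q : κ → ℝ) : Prop :=
  ∀ k : ℕ, kMaxSum q k ≤ kMaxSum p k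

/-- Fidelity `F(p,q) = (Σ_i √(p_i q_i))²`. -/
def fidelity {ι : Type*} [Fintype ι] (p q : ι → ℝ) : ℝ :=
  (∑ i, Real.sqrt (p i * q i)) ^ 2

/-- Infidelity `δ(p,q) = 1 - F(p,q)`. -/
def infid {ι : Type*} [Fintype ι] (p q : ι → ℝ) : ℝ := 1 - fidelity p q

/-- The `n`-fold tensor (Kronecker) power of `a`, as a vector indexed by
`Fin n → Fin d` (a probability vector of dimension `d^n`). -/
def tensorPow {d : ℕ} (a : Fin d → ℝ) (n : ℕ) : (Fin n → Fin d) → ℝ :=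
  fun f => ∏ j, a (f j)

/-- Shannon entropy `H(p) = -Σ_i p_i log p_i`. -/
def shannonH {ι : Type*} [Fintype ι] (p : ι → ℝ) : ℝ := -∑ i, p i * Real.log (p i)

/-- Entropy variance `V(p) = Σ_i p_i (-log p_i - H(p))²`. -/
def entVar {ι : Type*} [Fintype ι] (p : ι → ℝ) : ℝ :=
  ∑ i, p i * (-Real.log (p i) - shannonH p) ^ 2

/-- Relative entropy to the uniform distribution: `D(p) = log d - H(p)`. -/
def relD {d : ℕ} (p : Fin d → ℝ) : ℝ := Real.log d - shannonH p

/-- Density of the normal distribution with mean `μ` and variance `v`. -/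
def normPDF (μ v x : ℝ) : ℝ :=
  Real.exp (-((x - μ) ^ 2) / (2 * v)) / Real.sqrt (2 * Real.pi * v)

/-- Cumulative distribution function `Φ_{μ,v}` of the normal distribution. -/
def normCDF (μ v x : ℝ) : ℝ := ∫ t in Set.Iic x, normPDF μ v t

/-- The standard normal cumulative distribution function `Φ`. -/
def Phi (x : ℝ) : ℝ := normCDF 0 1 x

/-- A vector is flat if all of its non-zero entries are equal. -/
def IsFlat {ι : Type*} [Fintype ι] (p : ι → ℝ) : Prop :=
  ∀ i j, p i ≠ 0 → p j ≠ 0 → p i = p j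

/-- `P ≻_ε Q`: `P` ε-post-majorises `Q`, i.e. there is a probability vector `Q̃`
with `P ≻ Q̃` and `δ(Q,Q̃) ≤ ε`. -/
def PostMaj {ι κ : Type*} [Fintype ι] [Fintype κ] (ε : ℝ) (P : ι → ℝ) (Q : κ → ℝ) : Prop :=
  ∃ Qt : κ → ℝ, IsProbVec Qt ∧ Majorises P Qt ∧ infid Q Qt ≤ ε

theorem sum_le_kMaxSum {ι : Type*} [Fintype ι] (p : ι → ℝ) {k : ℕ} {s : Finset ι} (hs : #s ≤ k) :
    ∑ i ∈ s, p i ≤ kMaxSum p k :=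
  Finset.le_sup' (fun s => ∑ i ∈ s, p i) (by simpa using hs)

theorem kMaxSum_le {ι : Type*} [Fintype ι] {p : ι → ℝ} {k : ℕ} {c : ℝ}
    (h : ∀ s : Finset ι, #s ≤ k → ∑ i ∈ s, p i ≤ c) : kMaxSum p k ≤ c :=
  Finset.sup'_le _ _ fun s hs => h s (by simpa using hs)

/-- The uniform probability vector on the index set `S`. -/
def unifOn {ι : Type*} [DecidableEq ι] (S : Finset ι) : ι → ℝ :=
  fun i => if i ∈ S then (#S : ℝ)⁻¹ else 0

section UnifOn

variable {ι κ : Type*} [DecidableEq ι] [DecidableEq κ]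

theorem unifOn_nonneg (S : Finset ι) (i : ι) : 0 ≤ unifOn S i := by
  unfold unifOn; split_ifs <;> positivity

theorem unifOn_le (S : Finset ι) (i : ι) : unifOn S i ≤ (#S : ℝ)⁻¹ := by
  unfold unifOn; split_ifs
  · exact le_rfl
  · positivity

theorem unifOn_mul_unifOn (S : Finset ι) (T : Finset κ) (x : ι × κ) :
    unifOn S x.1 * unifOn T x.2 = unifOn (S ×ˢ T) x := by
  by_cases h1 : x.1 ∈ S <;> by_cases h2 : x.2 ∈ T <;>
    simp [unifOn, h1, h2, mul_comm]

theorem tensorPow_unifOn {d : ℕ} (S : Finset (Fin d)) (n : ℕ) :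
    tensorPow (unifOn S) n = unifOn (Fintype.piFinset fun _ : Fin n => S) := by
  funext f
  by_cases h : ∀ j, f j ∈ S
  · simp [tensorPow, unifOn, h]
  · obtain ⟨j, hj⟩ := not_forall.mp h
    simp only [tensorPow, unifOn, Fintype.mem_piFinset, h, if_false]
    exact Finset.prod_eq_zero (mem_univ j) (by simp [hj])

theorem unifOn_univ_fin {d : ℕ} : unifOn (univ : Finset (Fin d)) = fun _ => (d : ℝ)⁻¹ := by
  funext i; simp [unifOn]

variable [Fintype ι] [Fintype κ]

theorem isProbVec_unifOn {S : Finset ι} (hS : S.Nonempty) : IsProbVec (unifOn S) := by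
  refine ⟨unifOn_nonneg S, ?_⟩
  have : (#S : ℝ) ≠ 0 := by exact_mod_cast hS.card_pos.ne'
  simp [unifOn, this]

theorem IsFlat.exists_eq_unifOn {p : ι → ℝ} (hp : IsProbVec p) (hf : IsFlat p) :
    ∃ S : Finset ι, S.Nonempty ∧ p = unifOn S := by
  have hsum : ∑ i ∈ univ.filter (fun i => p i ≠ 0), p i = 1 := by
    rw [Finset.sum_filter_ne_zero, hp.2]
  refine ⟨univ.filter (fun i => p i ≠ 0), ?_, ?_⟩
  · by_contra h
    rw [Finset.not_nonempty_iff_eq_empty] at h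
    rw [h] at hsum
    simp at hsum
  · funext i
    by_cases hi : p i = 0
    · simp [unifOn, hi]
    · have hconst : ∑ j ∈ univ.filter (fun j => p j ≠ 0), p j
          = #(univ.filter (fun j => p j ≠ 0)) * p i := by
        rw [Finset.sum_congr rfl (fun j hj => hf j i (by simpa using hj) hi)]
        simp
      rw [hsum] at hconst
      simp only [unifOn, mem_filter, mem_univ, true_and, ne_eq, hi, not_false_eq_true, if_true]
      exact eq_inv_of_mul_eq_one_right hconst.symm

theorem shannonH_unifOn {S : Finset ι} (hS : S.Nonempty) :
    shannonH (unifOn S) = Real.log #S := by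
  have : (#S : ℝ) ≠ 0 := by exact_mod_cast hS.card_pos.ne'
  have h : ∀ i, unifOn S i * Real.log (unifOn S i)
      = if i ∈ S then (#S : ℝ)⁻¹ * Real.log (#S : ℝ)⁻¹ else 0 := by
    intro i; unfold unifOn; split_ifs <;> simp
  simp [shannonH, h, this]

theorem min_le_kMaxSum_unifOn {S : Finset ι} (hS : S.Nonempty) (k : ℕ) :
    min 1 (k * (#S : ℝ)⁻¹) ≤ kMaxSum (unifOn S) k := by
  have h0 : (#S : ℝ) ≠ 0 := by exact_mod_cast hS.card_pos.ne'
  have hsum : ∀ T ⊆ S, ∑ i ∈ T, unifOn S i = #T * (#S : ℝ)⁻¹ := by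
    intro T hT
    rw [Finset.sum_congr rfl (fun i hi => show unifOn S i = (#S : ℝ)⁻¹ from if_pos (hT hi))]
    simp
  rcases le_total (#S) k with h | h
  · refine (min_le_left _ _).trans ?_
    have := sum_le_kMaxSum (unifOn S) h
    rwa [hsum S subset_rfl, mul_inv_cancel₀ h0] at this
  · refine (min_le_right _ _).trans ?_
    obtain ⟨T, hT, hc⟩ := Finset.exists_subset_card_eq h
    have := sum_le_kMaxSum (unifOn S) hc.le
    rwa [hsum T hT, hc] at this

theorem majorises_unifOn_iff {κ : Type*} [Fintype κ] {S : Finset ι} (hS : S.Nonempty)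
    {q : κ → ℝ} (hq : IsProbVec q) :
    Majorises (unifOn S) q ↔ ∀ i, q i ≤ (#S : ℝ)⁻¹ := by
  constructor
  · intro h i
    have h1 : q i ≤ kMaxSum q 1 := by
      simpa using sum_le_kMaxSum q (s := {i}) (k := 1) (by simp)
    refine h1.trans ((h 1).trans (kMaxSum_le fun s hs => ?_))
    calc ∑ i ∈ s, unifOn S i ≤ #s • (#S : ℝ)⁻¹ :=
          Finset.sum_le_card_nsmul _ _ _ fun i _ => unifOn_le S i
      _ ≤ 1 • (#S : ℝ)⁻¹ := nsmul_le_nsmul_left (by positivity) hs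
      _ = _ := one_nsmul _
  · intro h k
    refine (kMaxSum_le fun s hs => le_min ?_ ?_).trans (min_le_kMaxSum_unifOn hS k)
    · rw [← hq.2]
      exact Finset.sum_le_sum_of_subset_of_nonneg (subset_univ _) fun i _ _ => hq.1 i
    · calc ∑ i ∈ s, q i ≤ #s • (#S : ℝ)⁻¹ :=
            Finset.sum_le_card_nsmul _ _ _ fun i _ => h i
        _ ≤ k • (#S : ℝ)⁻¹ := nsmul_le_nsmul_left (by positivity) hs
        _ = _ := nsmul_eq_mul _ _

theorem fidelity_unifOn_le {T : Finset κ} (hT : T.Nonempty) {q : κ → ℝ}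
    {c : ℝ} (hc : 0 ≤ c) (h : ∀ i, q i ≤ c) : fidelity (unifOn T) q ≤ #T * c := by
  have h0 : (#T : ℝ) ≠ 0 := by exact_mod_cast hT.card_pos.ne'
  have hs : ∑ i, √(unifOn T i * q i) ≤ #T * √((#T : ℝ)⁻¹ * c) := by
    calc ∑ i, √(unifOn T i * q i) ≤ ∑ i, if i ∈ T then √((#T : ℝ)⁻¹ * c) else 0 := by
          refine Finset.sum_le_sum fun i _ => ?_
          unfold unifOn
          split_ifs
          · gcongr; exact h i
          · simp
      _ = _ := by simp
  calc fidelity (unifOn T) q ≤ (#T * √((#T : ℝ)⁻¹ * c)) ^ 2 := by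
        unfold fidelity; gcongr
    _ = #T * c := by
        rw [mul_pow, Real.sq_sqrt (by positivity)]; field_simp

theorem fidelity_unifOn_of_subset {T U : Finset κ} (hT : T.Nonempty) (hTU : T ⊆ U) :
    fidelity (unifOn T) (unifOn U) = #T * (#U : ℝ)⁻¹ := by
  have h0 : (#T : ℝ) ≠ 0 := by exact_mod_cast hT.card_pos.ne'
  have h : ∀ i, √(unifOn T i * unifOn U i)
      = if i ∈ T then √((#T : ℝ)⁻¹ * (#U : ℝ)⁻¹) else 0 := by
    intro i
    by_cases hi : i ∈ T
    · simp only [unifOn, hi, hTU hi, if_true]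
    · simp [unifOn, hi]
  unfold fidelity
  simp_rw [h]
  rw [Finset.sum_ite_mem, Finset.univ_inter, Finset.sum_const, nsmul_eq_mul, mul_pow,
    Real.sq_sqrt (by positivity)]
  field_simp

theorem postMaj_unifOn_iff {S : Finset ι} {T : Finset κ} (hS : S.Nonempty) (hT : T.Nonempty)
    (hcard : Fintype.card ι = Fintype.card κ) {ε : ℝ} (hε : 0 ≤ ε) :
    PostMaj ε (unifOn S) (unifOn T) ↔ 1 - ε ≤ #T * (#S : ℝ)⁻¹ := by
  constructor
  · rintro ⟨Qt, hQt, hmaj, hinf⟩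
    have := fidelity_unifOn_le hT (by positivity) ((majorises_unifOn_iff hS hQt).mp hmaj)
    unfold infid at hinf
    linarith
  · intro h
    rcases le_total (#S) (#T) with hST | hTS
    · have hS0 : (0 : ℝ) < #S := by exact_mod_cast hS.card_pos
      have hT0 : (#T : ℝ) ≠ 0 := by exact_mod_cast hT.card_pos.ne'
      refine ⟨unifOn T, isProbVec_unifOn hT,
        (majorises_unifOn_iff hS (isProbVec_unifOn hT)).mpr fun i => (unifOn_le T i).trans ?_, ?_⟩
      · gcongr
      · rw [infid, fidelity_unifOn_of_subset hT subset_rfl, mul_inv_cancel₀ hT0]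
        simpa using hε
    · obtain ⟨U, hTU, -, hU⟩ := Finset.exists_subsuperset_card_eq (subset_univ T) hTS
        (by rw [card_univ, ← hcard]; exact card_le_univ S)
      have hUp := isProbVec_unifOn (hT.mono hTU)
      refine ⟨unifOn U, hUp, (majorises_unifOn_iff hS hUp).mpr fun i => ?_, ?_⟩
      · rw [← hU]; exact unifOn_le U i
      · rw [infid, fidelity_unifOn_of_subset hT hTU, hU]; linarith

end UnifOn

theorem csSup_setOf_cast_le (x : ℝ) (hx : 0 ≤ x) : sSup {m : ℕ | (m : ℝ) ≤ x} = ⌊x⌋₊ := by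
  have : {m : ℕ | (m : ℝ) ≤ x} = Set.Iic ⌊x⌋₊ := by
    ext m; simp [Nat.le_floor_iff hx]
  rw [this, csSup_Iic]

theorem relD_unifOn_nonneg {d : ℕ} {S : Finset (Fin d)} (hS : S.Nonempty) :
    0 ≤ relD (unifOn S) := by
  have h1 : (0 : ℝ) < #S := by exact_mod_cast hS.card_pos
  have h2 : (#S : ℝ) ≤ d := by exact_mod_cast (card_le_univ S).trans_eq (Fintype.card_fin d)
  rw [relD, shannonH_unifOn hS]
  linarith [Real.log_le_log h1 h2]

/-- exact flat-to-flat interconversion rate: for flat `p`, `q` with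
`D(q) > 0` and `ε ∈ [0,1)`, the optimal rate
`R*₀(n,ε) = (1/n) max{m : p^{⊗n} ⊗ η^{⊗m} ≻_ε q^{⊗m} ⊗ η^{⊗n}}` equals
`(1/n) ⌊(n D(p) - log(1-ε)) / D(q)⌋`. -/
theorem flat_to_flat_rate
    {d : ℕ} (p q : Fin d → ℝ) (hp : IsProbVec p) (hq : IsProbVec q)
    (hpf : IsFlat p) (hqf : IsFlat q) (hDq : 0 < relD q)
    (ε : ℝ) (hε : ε ∈ Set.Ico (0:ℝ) 1) (n : ℕ) (hn : 0 < n) :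
    ((sSup {m : ℕ | PostMaj ε
        (fun fg : (Fin n → Fin d) × (Fin m → Fin d) =>
          tensorPow p n fg.1 * tensorPow (fun _ : Fin d => (d : ℝ)⁻¹) m fg.2)
        (fun fg : (Fin m → Fin d) × (Fin n → Fin d) =>
          tensorPow q m fg.1 * tensorPow (fun _ : Fin d => (d : ℝ)⁻¹) n fg.2)} : ℕ) : ℝ)
      / n
    = ((⌊((n : ℝ) * relD p - Real.log (1 - ε)) / relD q⌋ : ℤ) : ℝ) / n := by
  obtain ⟨S, hS, rfl⟩ := hpf.exists_eq_unifOn hp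
  obtain ⟨T, hT, rfl⟩ := hqf.exists_eq_unifOn hq
  obtain ⟨hε0, hε1⟩ := hε
  have hd : Nonempty (Fin d) := ⟨hS.choose⟩
  have hd0 : (0 : ℝ) < d := by exact_mod_cast Fin.pos hS.choose
  have hS0 : (0 : ℝ) < #S := by exact_mod_cast hS.card_pos
  have hT0 : (0 : ℝ) < #T := by exact_mod_cast hT.card_pos
  have hmem : ∀ m : ℕ, PostMaj ε
        (fun fg : (Fin n → Fin d) × (Fin m → Fin d) =>
          tensorPow (unifOn S) n fg.1 * tensorPow (fun _ : Fin d => (d : ℝ)⁻¹) m fg.2)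
        (fun fg : (Fin m → Fin d) × (Fin n → Fin d) =>
          tensorPow (unifOn T) m fg.1 * tensorPow (fun _ : Fin d => (d : ℝ)⁻¹) n fg.2)
      ↔ (m : ℝ) ≤ ((n : ℝ) * relD (unifOn S) - Real.log (1 - ε)) / relD (unifOn T) := by
    intro m
    simp only [← unifOn_univ_fin, tensorPow_unifOn, unifOn_mul_unifOn]
    rw [postMaj_unifOn_iff _ _ (by simp [mul_comm]) hε0, le_div_iff₀ hDq,
      ← Real.log_le_log_iff (by linarith)]
    · simp only [card_product, Fintype.card_piFinset_const, Nat.cast_mul, Nat.cast_pow,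
        card_univ, Fintype.card_fin]
      rw [Real.log_mul (by positivity) (by positivity), Real.log_inv,
        Real.log_mul (by positivity) (by positivity), Real.log_mul (by positivity) (by positivity),
        Real.log_pow, Real.log_pow, Real.log_pow, Real.log_pow, relD, relD, shannonH_unifOn hS,
        shannonH_unifOn hT]
      constructor <;> intro h <;> linarith
    · simp only [card_product, Fintype.card_piFinset_const, Nat.cast_mul, Nat.cast_pow,
        card_univ, Fintype.card_fin]
      positivity
    · simp [hS]
    · simp [hT]
  have hx : 0 ≤ ((n : ℝ) * relD (unifOn S) - Real.log (1 - ε)) / relD (unifOn T) := by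
    have := relD_unifOn_nonneg hS
    have := Real.log_nonpos (x := 1 - ε) (by linarith) (by linarith)
    refine div_nonneg (sub_nonneg.mpr (this.trans ?_)) hDq.le
    positivity
  simp_rw [hmem]
  rw [csSup_setOf_cast_le _ hx, ← natCast_floor_eq_intCast_floor hx]
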